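/- arXiv:0908.1152 — 4 statements merged into one kernel-verified Lean document; each statement's English description precedes it below -/
import Mathlib

section
/- (Least Action Principle) Let V ⊆ ℤ^d be finite. If α and β are legal sequences of topplings for the configuration η such that β is contained in V and α stabilizes η in V, then m_β(x) ≤ m_α(x) for every x ∈ ℤ^d. -/
/-! Diaconis–Fulton representation for Activated Random Walks.

`NatRho` is ℕ ∪ {ρ}, ordered by 0 < ρ < 1 < 2 < ⋯, where `rho` represents one
passive particle. -/

inductive NatRho where
  | nat : ℕ → NatRho
  | rho : NatRho
  deriving DecidableEq

namespace NatRho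

/-- Embedding of `NatRho` into ℚ realizing the order 0 < ρ < 1 < 2 < ⋯. -/
def toVal : NatRho → ℚ
  | nat n => (n : ℚ)
  | rho => 1/2

instance : LE NatRho := ⟨fun a b => a.toVal ≤ b.toVal⟩
instance : LT NatRho := ⟨fun a b => a.toVal < b.toVal⟩

/-- Adding one particle: ρ + 1 = 2. -/
def succ : NatRho → NatRho
  | nat n => nat (n + 1)
  | rho => nat 2

/-- Removing one particle (only ever used when the value is ≥ 1). -/
def pred : NatRho → NatRho
  | nat (n + 1) => nat n
  | a => a

end NatRho

/-- An instruction: `move x y` is τ_{xy}, `sleep x` is τ_{xρ}, `neutral` is ι. -/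
inductive Instr (S : Type) where
  | move : S → S → Instr S
  | sleep : S → Instr S
  | neutral : Instr S
  deriving DecidableEq

/-- `ins.isAt x` : `ins` is an instruction at the site `x`. -/
def Instr.isAt {S : Type} (x : S) : Instr S → Prop
  | .move a b => a = x ∧ b ≠ x
  | .sleep a => a = x
  | .neutral => True

/-- An instruction array `I = (τ^{x,j})`. -/
abbrev InstrArray (S : Type) := S → ℕ → Instr S

/-- Well-formed instruction array: `I x j` is an instruction at `x`. -/
def InstrArray.WF {S : Type} (I : InstrArray S) : Prop := ∀ x j, (I x j).isAt x

variable {S : Type} [DecidableEq S]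

/-- Action of a single instruction on a configuration. -/
def applyInstr (ins : Instr S) (η : S → NatRho) : S → NatRho :=
  match ins with
  | .move x y => fun z => if z = x then (η x).pred else if z = y then (η y).succ else η z
  | .sleep x => fun z => if z = x ∧ η x = .nat 1 then .rho else η z
  | .neutral => η

/-- One toppling step at `x` from the state (configuration, odometer). -/
def step (I : InstrArray S) (st : (S → NatRho) × (S → ℕ)) (x : S) :
    (S → NatRho) × (S → ℕ) :=
  (applyInstr (I x (st.2 x + 1)) st.1, Function.update st.2 x (st.2 x + 1))

/-- Running a sequence of topplings from a given state. -/
def runFrom (I : InstrArray S) (st : (S → NatRho) × (S → ℕ)) (α : List S) :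
    (S → NatRho) × (S → ℕ) :=
  α.foldl (step I) st

/-- A site `x` is unstable in `η` if `η x ≥ 1`. -/
def Unstable (η : S → NatRho) (x : S) : Prop := NatRho.nat 1 ≤ η x

/-- A site `x` is stable in `η` if `η x ∈ {0, ρ}`. -/
def Stable (η : S → NatRho) (x : S) : Prop := ¬ Unstable η x

/-- `α` is a legal sequence of topplings from the state `st`: each toppled site is
unstable at the moment of its toppling. -/
def LegalFrom (I : InstrArray S) : ((S → NatRho) × (S → ℕ)) → List S → Prop
  | _, [] => True
  | st, x :: rest => Unstable st.1 x ∧ LegalFrom I (step I st x) rest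

/-- `α` is a legal sequence of topplings for the configuration `η` (odometer starting
from 0). -/
def Legal (I : InstrArray S) (η : S → NatRho) (α : List S) : Prop :=
  LegalFrom I (η, fun _ => 0) α

/-- `Φ_α η`: the result of the sequence of topplings `α` on `η`. -/
def topple (I : InstrArray S) (η : S → NatRho) (α : List S) : S → NatRho :=
  (runFrom I (η, fun _ => 0) α).1

theorem unstable_iff_exists (η : S → NatRho) (x : S) :
    Unstable η x ↔ ∃ n, η x = .nat (n + 1) := by
  unfold Unstable
  change NatRho.toVal (.nat 1) ≤ (η x).toVal ↔ _
  rcases η x with (_ | n) | _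
  · norm_num [NatRho.toVal]
  · simp only [NatRho.toVal, NatRho.nat.injEq, Nat.add_right_cancel_iff, exists_eq', iff_true]
    exact_mod_cast Nat.succ_le_succ n.zero_le
  · simp only [reduceCtorEq, exists_false, iff_false]
    norm_num [NatRho.toVal]

/-- An instruction at another site never stabilizes `x`. -/
theorem Unstable.applyInstr_of_ne {η : S → NatRho} {x y : S} (hx : Unstable η x) (hxy : x ≠ y)
    {a : Instr S} (ha : a.isAt y) : Unstable (applyInstr a η) x := by
  rw [unstable_iff_exists] at *
  obtain ⟨n, hn⟩ := hx
  cases a <;> simp only [applyInstr] <;> grind [Instr.isAt, NatRho.succ]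

/-- Instructions at distinct unstable sites commute. -/
theorem applyInstr_comm {η : S → NatRho} {x y : S} (hx : Unstable η x) (hy : Unstable η y)
    (hxy : x ≠ y) {a b : Instr S} (ha : a.isAt x) (hb : b.isAt y) :
    applyInstr a (applyInstr b η) = applyInstr b (applyInstr a η) := by
  rw [unstable_iff_exists] at hx hy
  obtain ⟨m, hm⟩ := hx
  obtain ⟨n, hn⟩ := hy
  funext z
  cases a <;> cases b <;> simp only [applyInstr] <;>
    grind [Instr.isAt, NatRho.succ, NatRho.pred]

theorem Unstable.step_of_ne {I : InstrArray S} (hI : I.WF) {st : (S → NatRho) × (S → ℕ)}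
    {x y : S} (hx : Unstable st.1 x) (hxy : x ≠ y) : Unstable (step I st y).1 x :=
  hx.applyInstr_of_ne hxy (hI _ _)

theorem step_comm {I : InstrArray S} (hI : I.WF) {st : (S → NatRho) × (S → ℕ)} {x y : S}
    (hx : Unstable st.1 x) (hy : Unstable st.1 y) (hxy : x ≠ y) :
    step I (step I st x) y = step I (step I st y) x := by
  simp only [step, Function.update_of_ne hxy, Function.update_of_ne hxy.symm]
  rw [applyInstr_comm hy hx hxy.symm (hI _ _) (hI _ _), Function.update_comm hxy]

theorem Unstable.runFrom_of_notMem {I : InstrArray S} (hI : I.WF) {x : S} {α : List S}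
    (hxα : x ∉ α) {st : (S → NatRho) × (S → ℕ)} (hx : Unstable st.1 x) :
    Unstable (runFrom I st α).1 x := by
  induction α generalizing st with
  | nil => exact hx
  | cons y t ih =>
    rw [List.mem_cons, not_or] at hxα
    exact ih hxα.2 (hx.step_of_ne hI hxα.1)

/-- The first toppling of an initially unstable site can be moved to the front of a legal
sequence, preserving legality and the final state. -/
theorem LegalFrom.erase {I : InstrArray S} (hI : I.WF) {x : S} {α : List S} (hxα : x ∈ α)
    {st : (S → NatRho) × (S → ℕ)} (hx : Unstable st.1 x) (hα : LegalFrom I st α) :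
    LegalFrom I (step I st x) (α.erase x) ∧
      runFrom I (step I st x) (α.erase x) = runFrom I st α := by
  induction α generalizing st with
  | nil => simp at hxα
  | cons y t ih =>
    by_cases hxy : x = y
    · subst hxy
      rw [List.erase_cons_head]
      exact ⟨hα.2, rfl⟩
    · obtain ⟨hlegal, hrun⟩ := ih (List.mem_of_ne_of_mem hxy hxα) (hx.step_of_ne hI hxy) hα.2
      rw [List.erase_cons_tail (by simpa using Ne.symm hxy)]
      rw [← step_comm hI hx hα.1 hxy] at hlegal hrun
      exact ⟨⟨hα.1.step_of_ne hI (Ne.symm hxy), hlegal⟩, hrun⟩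

theorem LegalFrom.count_le_count {I : InstrArray S} (hI : I.WF) {V : Set S} {α β : List S}
    {st : (S → NatRho) × (S → ℕ)} (hα : LegalFrom I st α) (hβ : LegalFrom I st β)
    (hβV : ∀ y ∈ β, y ∈ V) (hstab : ∀ y ∈ V, Stable (runFrom I st α).1 y) (x : S) :
    β.count x ≤ α.count x := by
  induction β generalizing st α with
  | nil => simp
  | cons y t ih =>
    have hyα : y ∈ α := by
      by_contra h
      exact hstab y (hβV y List.mem_cons_self) (hβ.1.runFrom_of_notMem hI h)
    obtain ⟨hlegal, hrun⟩ := hα.erase hI hyα hβ.1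
    have hle := ih hlegal hβ.2 (fun z hz => hβV z (List.mem_cons_of_mem y hz))
      (by rwa [hrun])
    rw [(List.perm_cons_erase hyα).count_eq x, List.count_cons, List.count_cons]
    exact Nat.add_le_add_right hle _

/-- Least Action Principle: if `β` is a legal sequence of topplings
contained in the finite set `V` and the legal sequence `α` stabilizes `η` in `V`,
then `m_β ≤ m_α`. -/
theorem arw_least_action_principle
    {d : ℕ} (hd : 1 ≤ d) (I : InstrArray (Fin d → ℤ)) (hI : I.WF)
    (η : (Fin d → ℤ) → NatRho) (V : Finset (Fin d → ℤ)) (α β : List (Fin d → ℤ))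
    (hα : Legal I η α) (hβ : Legal I η β)
    (hβV : ∀ y ∈ β, y ∈ V)
    (hstab : ∀ y ∈ V, Stable (topple I η α) y) :
    ∀ x, β.count x ≤ α.count x := by
  exact hα.count_le_count hI (V := V) hβ hβV hstab
end

section
/- (Monotonicity) Let V ⊆ V' be finite subsets of ℤ^d and let η ≤ η' be configurations (pointwise in the order on ℕρ). If β is a legal sequence of topplings for η, contained in V, stabilizing η in V, and α is a legal sequence of topplings for η', contained in V', stabilizing η' in V', then m_β(x) ≤ m_α(x) for every x ∈ ℤ^d. Equivalently, m_V(x; η) ≤ m_{V'}(x; η'). -/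
variable {S : Type} [DecidableEq S]

namespace NatRho

theorem le_def {a b : NatRho} : a ≤ b ↔ a.toVal ≤ b.toVal := Iff.rfl

theorem one_le_iff {a : NatRho} : nat 1 ≤ a ↔ ∃ n, a = nat (n + 1) := by
  constructor
  · intro h
    cases a with
    | nat n =>
      have : 1 ≤ n := by simpa [le_def, toVal] using h
      exact ⟨n - 1, by congr 1; omega⟩
    | rho => norm_num [le_def, toVal] at h
  · rintro ⟨n, rfl⟩
    simp [le_def, toVal]

theorem le_trans {a b c : NatRho} (hab : a ≤ b) (hbc : b ≤ c) : a ≤ c :=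
  _root_.le_trans (show a.toVal ≤ b.toVal from hab) hbc

theorem le_succ (a : NatRho) : a ≤ a.succ := by
  cases a <;> norm_num [le_def, toVal, succ]

theorem succ_le_succ {a b : NatRho} (h : a ≤ b) : a.succ ≤ b.succ := by
  rcases a with n | _ <;> rcases b with m | _ <;> simp only [le_def, toVal, succ] at h ⊢
  · push_cast; linarith
  · have : n < 1 := by
      have : (n : ℚ) < 1 := by linarith
      exact_mod_cast this
    interval_cases n
    norm_num
  · have : 0 < m := by
      have : (0 : ℚ) < m := by linarith
      exact_mod_cast this
    exact_mod_cast (by omega : 2 ≤ m + 1)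
  · exact le_rfl

theorem iterate_succ_le_iterate_succ {a b : NatRho} (h : a ≤ b) {m n : ℕ} (hmn : m ≤ n) :
    succ^[m] a ≤ succ^[n] b := by
  induction hmn with
  | refl =>
    induction m with
    | zero => exact h
    | succ k ih => simpa only [Function.iterate_succ_apply'] using succ_le_succ ih
  | step _ ih =>
    rw [Function.iterate_succ_apply']
    exact le_trans ih (le_succ _)

end NatRho

/-- The effect of an instruction at a site on the occupation of that site. -/
def Instr.act (ins : Instr S) (v : NatRho) : NatRho :=
  match ins with
  | .move _ _ => v.pred
  | .sleep _ => if v = .nat 1 then .rho else v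
  | .neutral => v

omit [DecidableEq S] in
theorem Instr.act_le_act (ins : Instr S) {v w : NatRho} (hv : NatRho.nat 1 ≤ v) (hvw : v ≤ w) :
    ins.act v ≤ ins.act w := by
  obtain ⟨m, rfl⟩ := NatRho.one_le_iff.1 hv
  obtain ⟨n, rfl⟩ := NatRho.one_le_iff.1 (NatRho.le_trans hv hvw)
  have hmn : m ≤ n := by simpa [NatRho.le_def, NatRho.toVal] using hvw
  cases ins with
  | move _ _ => simpa [act, NatRho.pred, NatRho.le_def, NatRho.toVal] using hmn
  | sleep _ =>
    rcases m with _ | m <;> rcases n with _ | n <;>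
      simp [act, NatRho.le_def, NatRho.toVal] at hmn ⊢
    · have : (0 : ℚ) ≤ n := n.cast_nonneg
      norm_num
      linarith
    · exact hmn
  | neutral => exact hvw

omit [DecidableEq S] in
theorem Instr.act_succ (ins : Instr S) {v : NatRho} (hv : NatRho.nat 1 ≤ v) :
    ins.act v.succ = (ins.act v).succ := by
  obtain ⟨n, rfl⟩ := NatRho.one_le_iff.1 hv
  cases ins with
  | move _ _ => rfl
  | sleep _ => rcases n with _ | n <;> simp [act, NatRho.succ]
  | neutral => rfl

/-- The occupation of `x` after its first `k` instructions, starting from `v` and without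
arrivals. -/
def siteRun (I : InstrArray S) (x : S) (v : NatRho) : ℕ → NatRho
  | 0 => v
  | k + 1 => (I x (k + 1)).act (siteRun I x v k)

/-- The first `k` instructions at `x` are only used at occupations at least `1`. -/
def SiteLegal (I : InstrArray S) (x : S) (v : NatRho) (k : ℕ) : Prop :=
  ∀ j < k, NatRho.nat 1 ≤ siteRun I x v j

omit [DecidableEq S] in
theorem SiteLegal.siteRun_le {I : InstrArray S} {x : S} {v w : NatRho} {k : ℕ}
    (h : SiteLegal I x v k) (hvw : v ≤ w) : siteRun I x v k ≤ siteRun I x w k := by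
  induction k with
  | zero => exact hvw
  | succ k ih => exact Instr.act_le_act _ (h k k.lt_succ_self) (ih fun j hj => h j (by omega))

omit [DecidableEq S] in
theorem SiteLegal.siteRun_succ {I : InstrArray S} {x : S} {v : NatRho} {k : ℕ}
    (h : SiteLegal I x v k) : siteRun I x v.succ k = (siteRun I x v k).succ := by
  induction k with
  | zero => rfl
  | succ k ih =>
    rw [siteRun, ih fun j hj => h j (by omega), Instr.act_succ _ (h k k.lt_succ_self), siteRun]

omit [DecidableEq S] in
theorem SiteLegal.mono {I : InstrArray S} {x : S} {v w : NatRho} {k : ℕ}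
    (h : SiteLegal I x v k) (hvw : v ≤ w) : SiteLegal I x w k := fun j hj =>
  NatRho.le_trans (h j hj) (SiteLegal.siteRun_le (fun i hi => h i (hi.trans hj)) hvw)

/-- The number of particles sent to `x` by the sites of `W` when each site `y` uses its first
`m y` instructions. -/
def arrivals (I : InstrArray S) (W : Finset S) (m : S → ℕ) (x : S) : ℕ :=
  ∑ y ∈ W, ((Finset.Icc 1 (m y)).filter fun j => I y j = .move y x).card

theorem arrivals_mono (I : InstrArray S) (W : Finset S) {m n : S → ℕ} (h : ∀ y, m y ≤ n y)
    (x : S) : arrivals I W m x ≤ arrivals I W n x :=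
  Finset.sum_le_sum fun y _ => Finset.card_le_card <|
    Finset.filter_subset_filter _ (Finset.Icc_subset_Icc_right (h y))

theorem arrivals_update (I : InstrArray S) {W : Finset S} (m : S → ℕ) (x : S) {y : S}
    (hy : y ∈ W) :
    arrivals I W (Function.update m y (m y + 1)) x =
      arrivals I W m x + if I y (m y + 1) = .move y x then 1 else 0 := by
  unfold arrivals
  rw [← Finset.add_sum_erase _ _ hy, ← Finset.add_sum_erase W _ hy, add_right_comm]
  congr 1
  · rw [Function.update_self, ← Finset.insert_Icc_right_eq_Icc_add_one (by omega),
      Finset.filter_insert]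
    split_ifs
    · rw [Finset.card_insert_of_notMem (by simp)]
    · rfl
  · refine Finset.sum_congr rfl fun z hz => ?_
    rw [Function.update_of_ne (Finset.ne_of_mem_erase hz)]

/-- In the state `st` every occupation is what one gets from `η` when, at each site, all arrivals
from `W` come before all instructions, and these instructions are used legally. -/
def ArrivalsFirst (I : InstrArray S) (η : S → NatRho) (W : Finset S)
    (st : (S → NatRho) × (S → ℕ)) : Prop :=
  ∀ x, SiteLegal I x (NatRho.succ^[arrivals I W st.2 x] (η x)) (st.2 x) ∧
    st.1 x = siteRun I x (NatRho.succ^[arrivals I W st.2 x] (η x)) (st.2 x)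

theorem arrivalsFirst_init (I : InstrArray S) (η : S → NatRho) (W : Finset S) :
    ArrivalsFirst I η W (η, fun _ => 0) := fun x =>
  ⟨fun j hj => absurd hj (Nat.not_lt_zero j), by simp [arrivals, siteRun]⟩

theorem applyInstr_self {ins : Instr S} {y : S} (h : ins.isAt y) (η : S → NatRho) :
    applyInstr ins η y = ins.act (η y) := by
  cases ins with
  | move a b => obtain ⟨rfl, -⟩ := h; simp [applyInstr, Instr.act]
  | sleep a => cases h; by_cases hy : η y = .nat 1 <;> simp [applyInstr, Instr.act, hy]
  | neutral => rfl

theorem applyInstr_of_ne {ins : Instr S} {x y : S} (h : ins.isAt y) (hxy : x ≠ y)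
    (η : S → NatRho) :
    applyInstr ins η x = if ins = .move y x then (η x).succ else η x := by
  cases ins with
  | move a b =>
    obtain ⟨rfl, -⟩ := h
    by_cases hb : x = b
    · subst hb; simp [applyInstr, hxy]
    · simp [applyInstr, hxy, hb, Ne.symm hb]
  | sleep a => cases h; simp [applyInstr, hxy]
  | neutral => simp [applyInstr]

theorem ArrivalsFirst.step {I : InstrArray S} (hI : I.WF) {η : S → NatRho} {W : Finset S}
    {st : (S → NatRho) × (S → ℕ)} (h : ArrivalsFirst I η W st) {y : S} (hy : y ∈ W)
    (hu : Unstable st.1 y) : ArrivalsFirst I η W (step I st y) := by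
  intro x
  obtain ⟨hlegal, hval⟩ := h x
  have hat := hI y (st.2 y + 1)
  simp only [_root_.step, arrivals_update I st.2 x hy]
  by_cases hxy : x = y
  · subst hxy
    have hself : I x (st.2 x + 1) ≠ .move x x := fun h => by
      rw [h] at hat
      exact hat.2 rfl
    rw [if_neg hself, add_zero, Function.update_self, applyInstr_self hat, hval]
    refine ⟨fun j hj => ?_, rfl⟩
    rcases Nat.lt_succ_iff_lt_or_eq.1 hj with hj | rfl
    · exact hlegal j hj
    · rw [← hval]
      exact hu
  · rw [applyInstr_of_ne hat hxy, Function.update_of_ne hxy]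
    split_ifs
    · rw [Function.iterate_succ_apply', hlegal.siteRun_succ, hval]
      exact ⟨hlegal.mono (NatRho.le_succ _), rfl⟩
    · exact ⟨hlegal, hval⟩

theorem ArrivalsFirst.runFrom {I : InstrArray S} (hI : I.WF) {η : S → NatRho} {W : Finset S}
    {α : List S} {st : (S → NatRho) × (S → ℕ)} (h : ArrivalsFirst I η W st)
    (hα : LegalFrom I st α) (hαW : ∀ y ∈ α, y ∈ W) : ArrivalsFirst I η W (runFrom I st α) := by
  induction α generalizing st with
  | nil => exact h
  | cons y α ih =>
    exact ih (h.step hI (hαW y List.mem_cons_self) hα.1) hα.2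
      fun z hz => hαW z (List.mem_cons_of_mem y hz)

theorem ArrivalsFirst.le_of_odometer_le {I : InstrArray S} {η η' : S → NatRho} {W : Finset S}
    {st st' : (S → NatRho) × (S → ℕ)} (h : ArrivalsFirst I η W st)
    (h' : ArrivalsFirst I η' W st') {x : S} (hle : η x ≤ η' x) (hodo : ∀ y, st.2 y ≤ st'.2 y)
    (hx : st.2 x = st'.2 x) : st.1 x ≤ st'.1 x := by
  rw [(h x).2, (h' x).2, ← hx]
  exact (h x).1.siteRun_le
    (NatRho.iterate_succ_le_iterate_succ hle (arrivals_mono I W hodo x))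

/-- Least action: a legal sequence cannot exceed the odometer of a stable state. -/
theorem ArrivalsFirst.runFrom_odometer_le {I : InstrArray S} (hI : I.WF) {η η' : S → NatRho}
    (hle : ∀ x, η x ≤ η' x) {W : Finset S} {st' : (S → NatRho) × (S → ℕ)}
    (h' : ArrivalsFirst I η' W st') (hstab : ∀ y ∈ W, Stable st'.1 y) {β : List S}
    {st : (S → NatRho) × (S → ℕ)} (h : ArrivalsFirst I η W st) (hβ : LegalFrom I st β)
    (hβW : ∀ y ∈ β, y ∈ W) (hodo : ∀ y, st.2 y ≤ st'.2 y) (x : S) :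
    (_root_.runFrom I st β).2 x ≤ st'.2 x := by
  induction β generalizing st with
  | nil => exact hodo x
  | cons y β ih =>
    have hy : y ∈ W := hβW y List.mem_cons_self
    refine ih (h.step hI hy hβ.1) hβ.2 (fun z hz => hβW z (List.mem_cons_of_mem y hz))
      fun z => ?_
    have hlt : st.2 y < st'.2 y := lt_of_le_of_ne (hodo y) fun heq =>
      hstab y hy (NatRho.le_trans hβ.1 (h.le_of_odometer_le h' (hle y) hodo heq))
    by_cases hz : z = y
    · subst hz
      simpa [_root_.step] using hlt
    · simpa [_root_.step, hz] using hodo z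

theorem runFrom_odometer (I : InstrArray S) (st : (S → NatRho) × (S → ℕ)) (α : List S) (x : S) :
    (runFrom I st α).2 x = st.2 x + α.count x := by
  induction α generalizing st with
  | nil => simp [runFrom]
  | cons y α ih =>
    refine (ih (step I st y)).trans ?_
    by_cases hx : x = y
    · subst hx
      simp [step]
      omega
    · simp [step, hx, Ne.symm hx]

/-- Monotonicity: if `V ⊆ V'` and `η ≤ η'` pointwise, then the odometer
of stabilization of `η` in `V` is dominated by that of `η'` in `V'`. -/
theorem arw_monotonicity
    {d : ℕ} (hd : 1 ≤ d) (I : InstrArray (Fin d → ℤ)) (hI : I.WF)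
    (η η' : (Fin d → ℤ) → NatRho) (hle : ∀ x, η x ≤ η' x)
    (V V' : Finset (Fin d → ℤ)) (hVV' : V ⊆ V') (α β : List (Fin d → ℤ))
    (hβ : Legal I η β) (hβV : ∀ y ∈ β, y ∈ V)
    (hstabβ : ∀ y ∈ V, Stable (topple I η β) y)
    (hα : Legal I η' α) (hαV : ∀ y ∈ α, y ∈ V')
    (hstabα : ∀ y ∈ V', Stable (topple I η' α) y) :
    ∀ x, β.count x ≤ α.count x := by
  intro x
  have hα' := (arrivalsFirst_init I η' V').runFrom hI hα hαV
  have key := hα'.runFrom_odometer_le hI hle hstabα (arrivalsFirst_init I η V') hβ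
    (fun y hy => hVV' (hβV y hy)) (fun _ => Nat.zero_le _) x
  simpa [runFrom_odometer] using key
end

section
/- (Abelian Property with half topplings) Let V ⊆ ℤ^d be finite and η a configuration. Let β be a legal toppling sequence (full topplings) contained in V that stabilizes η in V, and let α be a legal sequence of half topplings contained in V that stabilizes η in V. Then m̃_α(x) = m_β(x) for every x ∈ ℤ^d; that is, the half-toppling odometer of α equals the common odometer m_V of legal stabilizing full-toppling sequences in V. -/
/-! Diaconis–Fulton representation, with half topplings, for the Stochastic
Sandpile Model. Configurations are `ℕ`-valued; a site is unstable when it carries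
at least 2 grains. The instruction array `I x j : S` records the target of the
`j`-th instruction `τ_{x, I x j}` at `x`. -/

/-- Instruction array for the sandpile: `I x j` is the target of the `j`-th
instruction at `x`. -/
abbrev SandArray (S : Type) := S → ℕ → S

/-- Well-formedness: each instruction `τ_{xy}` has `y ≠ x`. -/
def SandArray.WF {S : Type} (I : SandArray S) : Prop := ∀ x j, I x j ≠ x

variable {S : Type} [DecidableEq S]

/-- Action of the instruction `τ_{y t}`: one grain moves from `y` to `t`. -/
def sandApply (y t : S) (η : S → ℕ) : S → ℕ :=
  fun z => if z = y then η y - 1 else if z = t then η t + 1 else η z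

/-- One half toppling at `y` from a state (configuration, half-step counter). -/
def hstep (I : SandArray S) (st : (S → ℕ) × (S → ℕ)) (y : S) : (S → ℕ) × (S → ℕ) :=
  (sandApply y (I y (st.2 y + 1)) st.1, Function.update st.2 y (st.2 y + 1))

/-- Running a sequence of half topplings from a given state. -/
def hrun (I : SandArray S) (st : (S → ℕ) × (S → ℕ)) (β : List S) : (S → ℕ) × (S → ℕ) :=
  β.foldl (hstep I) st

/-- `β` is a semi-legal sequence of half topplings from the state `st`: each half
toppled site holds at least one grain at the moment of its half toppling. -/
def SemiLegalFrom (I : SandArray S) : ((S → ℕ) × (S → ℕ)) → List S → Prop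
  | _, [] => True
  | st, y :: rest => 1 ≤ st.1 y ∧ SemiLegalFrom I (hstep I st y) rest

/-- `β` is a legal sequence of half topplings from the state `st`: each step is
semi-legal and, moreover, performed at a site which is unstable (`≥ 2` grains) or
semi-unstable (an odd number of half topplings so far). -/
def HalfLegalFrom (I : SandArray S) : ((S → ℕ) × (S → ℕ)) → List S → Prop
  | _, [] => True
  | st, y :: rest =>
      (1 ≤ st.1 y) ∧ (2 ≤ st.1 y ∨ Odd (st.2 y)) ∧ HalfLegalFrom I (hstep I st y) rest

/-- The half-toppling odometer `m̃_β(x)`, i.e. half the number of occurrences of `x`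
in `β`, as a rational number. -/
def halfOdo (β : List S) (x : S) : ℚ := (β.count x : ℚ) / 2

/-- A state is stable in `V` if every `x ∈ V` holds at most one grain, and holds no
grain at all if it has been half toppled an odd number of times. -/
def HalfStabilizes (st : (S → ℕ) × (S → ℕ)) (V : Finset S) : Prop :=
  ∀ x ∈ V, st.1 x ≤ 1 ∧ (Odd (st.2 x) → st.1 x = 0)

/-- The doubled sequence `α²`, repeating each entry twice. -/
def doubleSeq : List S → List S
  | [] => []
  | x :: r => x :: x :: doubleSeq r

/-- `α` is a legal sequence of full topplings from the state `st`: each toppled site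
is unstable (`≥ 2` grains) at the moment of its (full) toppling. -/
def FullLegalFrom (I : SandArray S) : ((S → ℕ) × (S → ℕ)) → List S → Prop
  | _, [] => True
  | st, x :: rest => 2 ≤ st.1 x ∧ FullLegalFrom I (hstep I (hstep I st x) x) rest

/-- `Φ_α η`: the result of the sequence of full topplings `α` on `η`, i.e.
`φ_{α²} η`. -/
def fullTopple (I : SandArray S) (η : S → ℕ) (α : List S) : S → ℕ :=
  (hrun I (η, fun _ => 0) (doubleSeq α)).1

/-- `α` is a legal sequence of full topplings for the configuration `η`. -/
def FullLegal (I : SandArray S) (η : S → ℕ) (α : List S) : Prop :=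
  FullLegalFrom I (η, fun _ => 0) α

/-- Mass balance: the grains at `x` together with the grains sent out of `x` are the initial
grains at `x` together with the grains sent to `x` from the sites of `V`. -/
def MassBalance (I : SandArray S) (η : S → ℕ) (V : Finset S) (st : (S → ℕ) × (S → ℕ)) : Prop :=
  ∀ x, st.1 x + st.2 x =
    η x + ∑ y ∈ V, ((Finset.range (st.2 y)).filter (fun j => I y (j + 1) = x)).card

lemma massBalance_init (I : SandArray S) (η : S → ℕ) (V : Finset S) :
    MassBalance I η V (η, fun _ => 0) := by
  intro x
  simp

lemma MassBalance.hstep_of_pos {I : SandArray S} (hI : I.WF) {η : S → ℕ} {V : Finset S}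
    {st : (S → ℕ) × (S → ℕ)} (h : MassBalance I η V st) {y : S} (hy : y ∈ V)
    (hpos : 1 ≤ st.1 y) : MassBalance I η V (hstep I st y) := by
  intro x
  have hx := h x
  have hne := hI y (st.2 y + 1)
  have hsum : ∑ z ∈ V, ((Finset.range (Function.update st.2 y (st.2 y + 1) z)).filter
        (fun j => I z (j + 1) = x)).card =
      ∑ z ∈ V, ((Finset.range (st.2 z)).filter (fun j => I z (j + 1) = x)).card +
        if I y (st.2 y + 1) = x then 1 else 0 := by
    rw [← Finset.add_sum_erase V _ hy, ← Finset.add_sum_erase V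
      (fun z => ((Finset.range (st.2 z)).filter (fun j => I z (j + 1) = x)).card) hy]
    have hrest : ∑ z ∈ V.erase y, ((Finset.range (Function.update st.2 y (st.2 y + 1) z)).filter
          (fun j => I z (j + 1) = x)).card =
        ∑ z ∈ V.erase y, ((Finset.range (st.2 z)).filter (fun j => I z (j + 1) = x)).card := by
      refine Finset.sum_congr rfl fun z hz => ?_
      rw [Function.update_of_ne (Finset.ne_of_mem_erase hz)]
    rw [hrest, Function.update_self, Finset.range_add_one, Finset.filter_insert]
    split_ifs
    · simp
      omega
    · simp
  simp only [hstep]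
  rw [hsum]
  simp only [sandApply]
  by_cases hxy : x = y
  · subst hxy
    simp only [if_true, Function.update_self, if_neg hne]
    omega
  · simp only [if_neg hxy, Function.update_of_ne hxy]
    by_cases ht : x = I y (st.2 y + 1)
    · rw [if_pos ht, if_pos ht.symm, ← ht]
      omega
    · rw [if_neg ht, if_neg (Ne.symm ht)]
      omega

lemma MassBalance.hrun_of_legal {I : SandArray S} (hI : I.WF) {η : S → ℕ} {V : Finset S} :
    ∀ {α : List S} {st : (S → ℕ) × (S → ℕ)}, MassBalance I η V st → HalfLegalFrom I st α →
      (∀ y ∈ α, y ∈ V) → MassBalance I η V (hrun I st α)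
  | [], _, h, _, _ => h
  | y :: α, st, h, hα, hV =>
    MassBalance.hrun_of_legal hI (α := α) (st := hstep I st y)
      (h.hstep_of_pos hI (hV y List.mem_cons_self) hα.1) hα.2.2
      fun z hz => hV z (List.mem_cons_of_mem y hz)

/-- Grains at a fixed site increase with the counters of the other sites. -/
lemma MassBalance.mono {I : SandArray S} {η : S → ℕ} {V : Finset S}
    {st st' : (S → ℕ) × (S → ℕ)} (h : MassBalance I η V st) (h' : MassBalance I η V st')
    (hle : st.2 ≤ st'.2) {x : S} (hx : st.2 x = st'.2 x) : st.1 x ≤ st'.1 x := by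
  have hsum : ∑ y ∈ V, ((Finset.range (st.2 y)).filter (fun j => I y (j + 1) = x)).card ≤
      ∑ y ∈ V, ((Finset.range (st'.2 y)).filter (fun j => I y (j + 1) = x)).card := by
    gcongr with y hy
    exact hle y
  have h₁ := h x
  have h₂ := h' x
  omega

/-- Least action principle for legal sequences of half topplings. -/
lemma hrun_snd_le_of_halfStabilizes {I : SandArray S} (hI : I.WF) {η : S → ℕ} {V : Finset S}
    {fin : (S → ℕ) × (S → ℕ)} (hfin : MassBalance I η V fin) (hstab : HalfStabilizes fin V) :
    ∀ {α : List S} {st : (S → ℕ) × (S → ℕ)}, MassBalance I η V st → HalfLegalFrom I st α →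
      (∀ y ∈ α, y ∈ V) → st.2 ≤ fin.2 → (hrun I st α).2 ≤ fin.2
  | [], _, _, _, _, hle => hle
  | y :: α, st, h, hα, hV, hle => by
    have hy : y ∈ V := hV y List.mem_cons_self
    refine hrun_snd_le_of_halfStabilizes hI hfin hstab (α := α) (st := hstep I st y)
      (h.hstep_of_pos hI hy hα.1) hα.2.2
      (fun z hz => hV z (List.mem_cons_of_mem y hz)) ?_
    have hlt : st.2 y < fin.2 y := by
      refine lt_of_le_of_ne (hle y) fun heq => ?_
      have hmono := h.mono hfin hle heq
      obtain ⟨h1, h0⟩ := hstab y hy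
      have hpos := hα.1
      rcases hα.2.1 with h2 | hodd
      · omega
      · have := h0 (heq ▸ hodd)
        omega
    intro z
    by_cases hz : z = y
    · subst hz
      simpa [hstep] using Nat.succ_le_of_lt hlt
    · simpa [hstep, Function.update_of_ne hz] using hle z

lemma hrun_snd_apply (I : SandArray S) (x : S) :
    ∀ (α : List S) (st : (S → ℕ) × (S → ℕ)), (hrun I st α).2 x = st.2 x + α.count x
  | [], _ => rfl
  | y :: α, st => by
    have ih := hrun_snd_apply I x α (hstep I st y)
    change (hrun I (hstep I st y) α).2 x = _
    rw [ih]
    by_cases hxy : x = y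
    · subst hxy
      simp only [hstep, Function.update_self, List.count_cons_self]
      omega
    · simp [hstep, Function.update_of_ne hxy, List.count_cons_of_ne (Ne.symm hxy)]

lemma count_doubleSeq (x : S) : ∀ β : List S, (doubleSeq β).count x = 2 * β.count x
  | [] => rfl
  | y :: β => by
    simp only [doubleSeq, List.count_cons, count_doubleSeq x β]
    ring

lemma mem_of_mem_doubleSeq {x : S} {β : List S} (h : x ∈ doubleSeq β) : x ∈ β := by
  rw [← List.count_pos_iff] at h ⊢
  rw [count_doubleSeq] at h
  omega

/-- A legal full toppling at an even counter is a pair of legal half topplings. -/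
lemma FullLegalFrom.halfLegalFrom_doubleSeq {I : SandArray S} :
    ∀ {β : List S} {st : (S → ℕ) × (S → ℕ)}, (∀ x, Even (st.2 x)) → FullLegalFrom I st β →
      HalfLegalFrom I st (doubleSeq β)
  | [], _, _, _ => trivial
  | x :: β, st, heven, h => by
    obtain ⟨h2, hrest⟩ := h
    refine ⟨by omega, Or.inl h2, ?_, Or.inr ?_,
      FullLegalFrom.halfLegalFrom_doubleSeq (fun z => ?_) hrest⟩
    · simp only [hstep, sandApply, if_true]
      omega
    · simpa [hstep] using (heven x).add_one
    · by_cases hz : z = x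
      · subst hz
        simpa [hstep, add_assoc] using (heven z).add even_two
      · simpa [hstep, Function.update_of_ne hz] using heven z

/-- Abelian Property with half topplings: if `β` is a legal stabilizing
sequence of full topplings contained in `V` and `α` is a legal stabilizing sequence of
half topplings contained in `V`, then `m̃_α = m_β`. -/
theorem ssm_abelian_property_half
    {d : ℕ} (hd : 1 ≤ d) (I : SandArray (Fin d → ℤ)) (hI : I.WF)
    (η : (Fin d → ℤ) → ℕ) (V : Finset (Fin d → ℤ)) (α β : List (Fin d → ℤ))
    (hβ : FullLegal I η β) (hβV : ∀ y ∈ β, y ∈ V)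
    (hstabβ : ∀ x ∈ V, fullTopple I η β x ≤ 1)
    (hα : HalfLegalFrom I (η, fun _ => 0) α) (hαV : ∀ y ∈ α, y ∈ V)
    (hstabα : HalfStabilizes (hrun I (η, fun _ => 0) α) V) :
    ∀ x, halfOdo α x = (β.count x : ℚ) := by
  have hinit := massBalance_init I η V
  have hβ' : HalfLegalFrom I (η, fun _ => 0) (doubleSeq β) :=
    FullLegalFrom.halfLegalFrom_doubleSeq (fun _ => Even.zero) hβ
  have hβV' : ∀ y ∈ doubleSeq β, y ∈ V := fun y hy => hβV y (mem_of_mem_doubleSeq hy)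
  have hstabβ' : HalfStabilizes (hrun I (η, fun _ => 0) (doubleSeq β)) V := by
    refine fun x hx => ⟨hstabβ x hx, fun hodd => absurd hodd ?_⟩
    rw [hrun_snd_apply, count_doubleSeq]
    simp
  intro x
  have h₁ := hrun_snd_le_of_halfStabilizes hI (hinit.hrun_of_legal hI hβ' hβV') hstabβ' hinit hα hαV
    (fun _ => Nat.zero_le _) x
  have h₂ := hrun_snd_le_of_halfStabilizes hI (hinit.hrun_of_legal hI hα hαV) hstabα hinit hβ' hβV'
    (fun _ => Nat.zero_le _) x
  simp only [hrun_snd_apply, count_doubleSeq] at h₁ h₂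
  have hcount : α.count x = 2 * β.count x := by omega
  rw [halfOdo, hcount]
  push_cast
  ring
end

section
/- If α and β are legal sequences of half topplings for the configuration η with m̃_α = m̃_β, then φ_α η = φ_β η. In other words, the result of a legal sequence of half topplings depends on the sequence only through its half-toppling odometer. -/
variable {S : Type} [DecidableEq S]

/-- Net balance at `z` of a state: its grains plus the half topplings made at `z`, minus the grains
sent to `z` by the instructions already used at the sites of `T`. -/
def hbalance (I : SandArray S) (T : Finset S) (st : (S → ℕ) × (S → ℕ)) (z : S) : ℤ :=
  (st.1 z : ℤ) + st.2 z -
    ∑ y ∈ T, ∑ j ∈ Finset.range (st.2 y), if I y (j + 1) = z then 1 else 0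

theorem hbalance_hstep {I : SandArray S} (hI : I.WF) {T : Finset S}
    {st : (S → ℕ) × (S → ℕ)} {y : S} (hy : y ∈ T) (hst : 1 ≤ st.1 y) (z : S) :
    hbalance I T (hstep I st y) z = hbalance I T st z := by
  have hsum : (∑ x ∈ T, ∑ j ∈ Finset.range ((hstep I st y).2 x),
        if I x (j + 1) = z then (1 : ℤ) else 0)
      = (∑ x ∈ T, ∑ j ∈ Finset.range (st.2 x), if I x (j + 1) = z then (1 : ℤ) else 0)
        + if I y (st.2 y + 1) = z then 1 else 0 := by
    have hterm : ∀ x ∈ T, (∑ j ∈ Finset.range ((hstep I st y).2 x),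
          if I x (j + 1) = z then (1 : ℤ) else 0)
        = (∑ j ∈ Finset.range (st.2 x), if I x (j + 1) = z then (1 : ℤ) else 0)
          + if x = y then (if I y (st.2 y + 1) = z then 1 else 0) else 0 := by
      intro x _
      by_cases hxy : x = y
      · subst hxy
        simp only [hstep, Function.update_self, Finset.sum_range_succ, if_true]
      · simp [hstep, hxy]
    rw [Finset.sum_congr rfl hterm, Finset.sum_add_distrib, Finset.sum_ite_eq' T y, if_pos hy]
  have hne := hI y (st.2 y + 1)
  unfold hbalance
  rw [hsum]
  by_cases hzy : z = y
  · subst hzy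
    simp only [hstep, sandApply, Function.update_self, if_true, if_neg hne]
    omega
  · by_cases hzt : z = I y (st.2 y + 1)
    · have ht : (hstep I st y).1 z = st.1 z + 1 := by
        simp [hstep, sandApply, hzy, ← hzt]
      have hk : (hstep I st y).2 z = st.2 z := by simp [hstep, hzy]
      rw [ht, hk, if_pos hzt.symm]
      omega
    · simp [hstep, sandApply, hzy, hzt, Ne.symm hzt]

theorem HalfLegalFrom.semiLegalFrom {I : SandArray S} {β : List S} :
    ∀ {st : (S → ℕ) × (S → ℕ)}, HalfLegalFrom I st β → SemiLegalFrom I st β := by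
  induction β with
  | nil => exact fun _ => trivial
  | cons y β ih => exact fun h => ⟨h.1, ih h.2.2⟩

theorem hbalance_hrun {I : SandArray S} (hI : I.WF) {T : Finset S} {β : List S}
    (hβT : ∀ y ∈ β, y ∈ T) {st : (S → ℕ) × (S → ℕ)} (hβ : SemiLegalFrom I st β) (z : S) :
    hbalance I T (hrun I st β) z = hbalance I T st z := by
  induction β generalizing st with
  | nil => rfl
  | cons y β ih =>
    exact (ih (fun x hx => hβT x (List.mem_cons_of_mem y hx)) hβ.2).trans
      (hbalance_hstep hI (hβT y List.mem_cons_self) hβ.1 z)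

theorem hrun_snd (I : SandArray S) (β : List S) (st : (S → ℕ) × (S → ℕ)) (x : S) :
    (hrun I st β).2 x = st.2 x + β.count x := by
  induction β generalizing st with
  | nil => rfl
  | cons y β ih =>
    refine (ih (hstep I st y)).trans ?_
    by_cases hxy : x = y
    · subst hxy
      simp [hstep]
      omega
    · simp [hstep, hxy, Ne.symm hxy]

/-- Semi-legal sequences with the same number of half topplings at each site lead to the same
configuration. -/
theorem hrun_fst_eq_of_count_eq {I : SandArray S} (hI : I.WF) {st : (S → ℕ) × (S → ℕ)}
    {α β : List S} (hα : SemiLegalFrom I st α) (hβ : SemiLegalFrom I st β)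
    (hcount : ∀ x, α.count x = β.count x) : (hrun I st α).1 = (hrun I st β).1 := by
  have hsnd : (hrun I st α).2 = (hrun I st β).2 := by
    funext x
    rw [hrun_snd, hrun_snd, hcount]
  have hsub : ∀ y ∈ β, y ∈ α.toFinset := fun y hy => by
    rw [List.mem_toFinset, ← List.count_pos_iff, hcount]
    exact List.count_pos_iff.2 hy
  funext z
  have h := (hbalance_hrun hI (fun y hy => List.mem_toFinset.2 hy) hα z).trans
    (hbalance_hrun hI hsub hβ z).symm
  unfold hbalance at h
  rw [hsnd] at h
  omega

/-- the result of a legal sequence of half topplings depends on the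
sequence only through its half-toppling odometer. -/
theorem ssm_half_result_depends_only_on_odometer
    {d : ℕ} (hd : 1 ≤ d) (I : SandArray (Fin d → ℤ)) (hI : I.WF)
    (η : (Fin d → ℤ) → ℕ) (α β : List (Fin d → ℤ))
    (hα : HalfLegalFrom I (η, fun _ => 0) α)
    (hβ : HalfLegalFrom I (η, fun _ => 0) β)
    (hm : ∀ x, halfOdo α x = halfOdo β x) :
    (hrun I (η, fun _ => 0) α).1 = (hrun I (η, fun _ => 0) β).1 := by
  refine hrun_fst_eq_of_count_eq hI hα.semiLegalFrom hβ.semiLegalFrom fun x => ?_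
  have h := hm x
  unfold halfOdo at h
  have hcast : (α.count x : ℚ) = β.count x := by linarith
  exact_mod_cast hcast
end
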